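/- (Main atom estimate, core of Theorem 1(a)) Let 0 < p ≤ 1/2, assume λ = sup_k m_k < ∞, and let (n_k)_{k≥0} be a sequence of positive integers with sup_k (|n_k| − ⟨n_k⟩) ≤ A < ∞. Then there exists a constant C, depending only on p, λ and A, such that for every N ∈ ℕ and every bounded measurable a : G_m → ℂ with support contained in I_N, ‖a‖_∞ ≤ M_N^{1/p}, and ∫_{G_m} a dμ = 0, one has ∫_{G_m \ I_N} (sup_{k∈ℕ} |σ_{n_k} a(x)|)^p dμ(x) ≤ C. -/

import Mathlib

open MeasureTheory Finset

noncomputable section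

namespace Vilenkin

instance (n : ℕ) : MeasurableSpace (ZMod n) := ⊤

abbrev G (m : ℕ → ℕ) : Type := ∀ k, ZMod (m k)

def M (m : ℕ → ℕ) : ℕ → ℕ
  | 0 => 1
  | k + 1 => m k * M m k

def digit (m : ℕ → ℕ) (n k : ℕ) : ℕ := (n / M m k) % m k

def rad (m : ℕ → ℕ) (k : ℕ) (x : G m) : ℂ :=
  Complex.exp (2 * (Real.pi : ℂ) * Complex.I * ((x k).val : ℂ) / (m k : ℂ))

def psi (m : ℕ → ℕ) (n : ℕ) (x : G m) : ℂ :=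
  ∏ k ∈ Finset.range (n + 1), rad m k x ^ digit m n k

def D (m : ℕ → ℕ) (n : ℕ) (x : G m) : ℂ := ∑ k ∈ Finset.range n, psi m k x

def K (m : ℕ → ℕ) (n : ℕ) (x : G m) : ℂ := (n : ℂ)⁻¹ * ∑ k ∈ Finset.range n, D m k x

def cyl (m : ℕ → ℕ) (n : ℕ) (x : G m) : Set (G m) := {y | ∀ j < n, y j = x j}

def e (m : ℕ → ℕ) (k : ℕ) : G m := fun j => if j = k then 1 else 0

def lo (m : ℕ → ℕ) (n : ℕ) : ℕ := sInf {j | digit m n j ≠ 0}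

def hi (m : ℕ → ℕ) (n : ℕ) : ℕ := sSup {j | digit m n j ≠ 0}

def Iij (m : ℕ → ℕ) (N i j : ℕ) : Set (G m) :=
  if j = N then {x | x i ≠ 0 ∧ ∀ t < N, t ≠ i → x t = 0}
  else {x | (∀ t < i, x t = 0) ∧ x i ≠ 0 ∧ (∀ t, i < t → t < j → x t = 0) ∧ x j ≠ 0}

def IsVilenkinMeasure (m : ℕ → ℕ) (μ : Measure (G m)) : Prop :=
  IsProbabilityMeasure μ ∧ ∀ (n : ℕ) (x : G m), μ (cyl m n x) = (M m n : ENNReal)⁻¹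

def fhat (m : ℕ → ℕ) (μ : Measure (G m)) (f : G m → ℂ) (k : ℕ) : ℂ :=
  ∫ x, f x * (starRingEnd ℂ) (psi m k x) ∂μ

def S (m : ℕ → ℕ) (μ : Measure (G m)) (f : G m → ℂ) (n : ℕ) (x : G m) : ℂ :=
  ∑ k ∈ Finset.range n, fhat m μ f k * psi m k x

def sigma (m : ℕ → ℕ) (μ : Measure (G m)) (f : G m → ℂ) (n : ℕ) (x : G m) : ℂ :=
  (n : ℂ)⁻¹ * ∑ k ∈ Finset.range n, S m μ f k x

end Vilenkin

namespace Vilenkin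

lemma M_pos {m : ℕ → ℕ} (hm : ∀ k, 2 ≤ m k) (k : ℕ) : 0 < M m k := by
  induction k with
  | zero => simp [M]
  | succ k ih => exact Nat.mul_pos (by have := hm k; omega) ih

lemma two_pow_mul_M_le {m : ℕ → ℕ} (hm : ∀ k, 2 ≤ m k) (k d : ℕ) :
    2 ^ d * M m k ≤ M m (k + d) := by
  induction d with
  | zero => simp
  | succ d ih =>
    calc 2 ^ (d + 1) * M m k = 2 * (2 ^ d * M m k) := by ring
      _ ≤ m (k + d) * M m (k + d) := Nat.mul_le_mul (hm _) ih

lemma M_add_le {m : ℕ → ℕ} {lam : ℕ} (hl : ∀ k, m k ≤ lam) (k d : ℕ) :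
    M m (k + d) ≤ lam ^ d * M m k := by
  induction d with
  | zero => simp
  | succ d ih =>
    calc m (k + d) * M m (k + d) ≤ lam * (lam ^ d * M m k) := Nat.mul_le_mul (hl _) ih
      _ = lam ^ (d + 1) * M m k := by ring

lemma M_dvd (m : ℕ → ℕ) {i j : ℕ} (h : i ≤ j) : M m i ∣ M m j := by
  induction j, h using Nat.le_induction with
  | base => exact dvd_rfl
  | succ j _ ih => exact ih.mul_left _

lemma lt_M {m : ℕ → ℕ} (hm : ∀ k, 2 ≤ m k) (k : ℕ) : k < M m k := by
  have h := two_pow_mul_M_le hm 0 k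
  simp only [M, mul_one, zero_add] at h
  exact Nat.lt_two_pow_self.trans_le h

lemma digit_eq_zero_of_lt (m : ℕ → ℕ) {n k : ℕ} (h : n < M m k) : digit m n k = 0 := by
  simp [digit, Nat.div_eq_of_lt h]

lemma digit_mul_M_of_lt {m : ℕ → ℕ} (hm : ∀ k, 2 ≤ m k) (q : ℕ) {i k : ℕ} (h : k < i) :
    digit m (q * M m i) k = 0 := by
  obtain ⟨c, hc⟩ := M_dvd m (Nat.succ_le_of_lt h)
  have : q * M m i = M m k * (m k * (q * c)) := by rw [hc]; simp only [M]; ring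
  rw [digit, this, Nat.mul_div_cancel_left _ (M_pos hm k), Nat.mul_mod_right]

lemma digit_add {m : ℕ → ℕ} (hm : ∀ k, 2 ≤ m k) (q : ℕ) {i r : ℕ} (hr : r < M m i) (k : ℕ) :
    digit m (q * M m i + r) k = digit m (q * M m i) k + digit m r k := by
  rcases lt_or_ge k i with h | h
  · rw [digit_mul_M_of_lt hm q h, zero_add]
    obtain ⟨c, hc⟩ := M_dvd m (Nat.succ_le_of_lt h)
    have : q * M m i + r = r + M m k * (m k * (q * c)) := by rw [hc]; simp only [M]; ring
    rw [digit, this, Nat.add_mul_div_left _ _ (M_pos hm k), Nat.add_mul_mod_self_left, digit]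
  · have hMi := M_pos hm i
    obtain ⟨c, hc⟩ := M_dvd m h
    rw [digit_eq_zero_of_lt m (hr.trans_le (Nat.le_of_dvd (M_pos hm k) (M_dvd m h))), add_zero]
    simp only [digit, hc, ← Nat.div_div_eq_div_mul]
    rw [Nat.mul_div_cancel _ hMi, mul_comm q, Nat.mul_add_div hMi, Nat.div_eq_of_lt hr, add_zero]

lemma M_lo_dvd (m : ℕ → ℕ) (n : ℕ) : M m (lo m n) ∣ n := by
  suffices h : ∀ i ≤ lo m n, M m i ∣ n from h _ le_rfl
  intro i
  induction i with
  | zero => simp [M]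
  | succ i ih =>
    intro hi
    have h0 : digit m n i = 0 := by
      simpa using Nat.notMem_of_lt_sInf (s := {j | digit m n j ≠ 0}) (Nat.lt_of_succ_le hi)
    obtain ⟨c, rfl⟩ := ih (by omega)
    rcases Nat.eq_zero_or_pos (M m i) with hz | hp
    · simp [hz]
    rw [digit, Nat.mul_div_cancel_left _ hp] at h0
    rw [M, mul_comm]
    exact Nat.mul_dvd_mul_left _ (Nat.dvd_of_mod_eq_zero h0)

lemma le_hi {m : ℕ → ℕ} (hm : ∀ k, 2 ≤ m k) {n N : ℕ} (h : M m N ≤ n) : N ≤ hi m n := by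
  by_contra! hlt
  have hb : BddAbove {j | digit m n j ≠ 0} := by
    refine ⟨n, fun j hj => ?_⟩
    by_contra! hnj
    exact hj (digit_eq_zero_of_lt m (hnj.trans (lt_M hm j)))
  have h0 : ∀ j, N ≤ j → digit m n j = 0 := by
    intro j hj
    by_contra hne
    exact absurd (le_csSup hb hne) (by change ¬ j ≤ hi m n; omega)
  have key : ∀ d, n / M m (N + d) = 0 → n / M m N = 0 := by
    intro d
    induction d with
    | zero => exact id
    | succ d ih =>
      intro hd
      apply ih
      have h1 : n / M m (N + d) / m (N + d) = 0 := by
        rw [Nat.div_div_eq_div_mul, mul_comm]; exact hd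
      have h2 := Nat.div_add_mod (n / M m (N + d)) (m (N + d))
      have h3 : n / M m (N + d) % m (N + d) = 0 := h0 _ (by omega)
      rw [h1, h3] at h2
      omega
  have hz := key n (Nat.div_eq_of_lt (((Nat.le_add_left n N).trans_lt (lt_M hm _))))
  have := Nat.div_pos h (M_pos hm N)
  omega

/-- The Vilenkin functions, with the values of the Rademacher functions at a point replaced by
an arbitrary sequence of complex numbers. -/
def psiSeq (m : ℕ → ℕ) (z : ℕ → ℂ) (n : ℕ) : ℂ :=
  ∏ k ∈ range (n + 1), z k ^ digit m n k

/-- The Dirichlet kernels formed from `psiSeq`. -/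
def dirichletSeq (m : ℕ → ℕ) (z : ℕ → ℂ) (n : ℕ) : ℂ := ∑ k ∈ range n, psiSeq m z k

section Kernel

variable {m : ℕ → ℕ} {z : ℕ → ℂ}

lemma psiSeq_eq_prod (hm : ∀ k, 2 ≤ m k) {n L : ℕ} (h : n < L) :
    psiSeq m z n = ∏ k ∈ range L, z k ^ digit m n k := by
  refine prod_subset (range_subset_range.2 h) fun k _ hk => ?_
  rw [digit_eq_zero_of_lt m, pow_zero]
  have := lt_M hm k
  simp only [mem_range] at hk
  omega

lemma psiSeq_add (hm : ∀ k, 2 ≤ m k) (q : ℕ) {i r : ℕ} (hr : r < M m i) :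
    psiSeq m z (q * M m i + r) = psiSeq m z (q * M m i) * psiSeq m z r := by
  have h1 : q * M m i < q * M m i + r + 1 := by omega
  have h2 : r < q * M m i + r + 1 := by omega
  rw [psiSeq_eq_prod hm h1, psiSeq_eq_prod hm h2, psiSeq, ← prod_mul_distrib]
  simp only [digit_add hm q hr, pow_add]

lemma psiSeq_mul_M (hm : ∀ k, 2 ≤ m k) {s d : ℕ} (hd : d < m s) :
    psiSeq m z (d * M m s) = z s ^ d := by
  have h1 : d * M m s < d * M m s + s + 1 := by omega
  rw [psiSeq_eq_prod hm h1, prod_eq_single s]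
  · rw [digit, Nat.mul_div_cancel _ (M_pos hm s), Nat.mod_eq_of_lt hd]
  · intro k _ hk
    rcases lt_or_gt_of_ne hk with h | h
    · rw [digit_mul_M_of_lt hm d h, pow_zero]
    · rw [digit_eq_zero_of_lt m, pow_zero]
      calc d * M m s < m s * M m s := Nat.mul_lt_mul_of_pos_right hd (M_pos hm s)
        _ = M m (s + 1) := rfl
        _ ≤ M m k := Nat.le_of_dvd (M_pos hm k) (M_dvd m h)
  · intro h
    simp at h

lemma norm_psiSeq (hz : ∀ k, ‖z k‖ = 1) (n : ℕ) : ‖psiSeq m z n‖ = 1 := by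
  simp [psiSeq, hz]

lemma sum_range_mul_eq (f : ℕ → ℂ) (q B : ℕ) :
    ∑ k ∈ range (q * B), f k = ∑ d ∈ range q, ∑ r ∈ range B, f (d * B + r) := by
  induction q with
  | zero => simp
  | succ q ih => rw [add_mul, one_mul, sum_range_add, ih, sum_range_succ]

lemma sum_pow_eq_zero {w : ℂ} {n : ℕ} (h1 : w ^ n = 1) (h2 : w ≠ 1) :
    ∑ d ∈ range n, w ^ d = 0 := by
  rw [geom_sum_eq h2, h1, sub_self, zero_div]

lemma dirichletSeq_M_succ (hm : ∀ k, 2 ≤ m k) {s : ℕ} (hs : z s ^ m s = 1) (hs' : z s ≠ 1) :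
    dirichletSeq m z (M m (s + 1)) = 0 := by
  rw [dirichletSeq, M, sum_range_mul_eq]
  have : ∀ d ∈ range (m s), ∑ r ∈ range (M m s), psiSeq m z (d * M m s + r) =
      z s ^ d * ∑ r ∈ range (M m s), psiSeq m z r := by
    intro d hd
    rw [mul_sum]
    refine sum_congr rfl fun r hr => ?_
    rw [psiSeq_add hm d (mem_range.1 hr), psiSeq_mul_M hm (mem_range.1 hd)]
  rw [sum_congr rfl this, ← sum_mul, sum_pow_eq_zero hs hs', zero_mul]

lemma dirichletSeq_mul_M_succ (hm : ∀ k, 2 ≤ m k) {s : ℕ} (hs : z s ^ m s = 1) (hs' : z s ≠ 1)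
    (q : ℕ) : dirichletSeq m z (q * M m (s + 1)) = 0 := by
  rw [dirichletSeq, sum_range_mul_eq]
  refine sum_eq_zero fun d _ => ?_
  have : ∀ r ∈ range (M m (s + 1)), psiSeq m z (d * M m (s + 1) + r) =
      psiSeq m z (d * M m (s + 1)) * psiSeq m z r :=
    fun r hr => psiSeq_add hm d (mem_range.1 hr)
  rw [sum_congr rfl this, ← mul_sum]
  exact mul_eq_zero_of_right _ (dirichletSeq_M_succ hm hs hs')

lemma dirichletSeq_of_dvd (hm : ∀ k, 2 ≤ m k) {s n : ℕ} (hs : z s ^ m s = 1) (hs' : z s ≠ 1)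
    (h : M m (s + 1) ∣ n) : dirichletSeq m z n = 0 := by
  obtain ⟨q, rfl⟩ := h
  rw [mul_comm]
  exact dirichletSeq_mul_M_succ hm hs hs' q

lemma dirichletSeq_add (hm : ∀ k, 2 ≤ m k) {s i : ℕ} (hs : z s ^ m s = 1) (hs' : z s ≠ 1)
    (hi : s < i) (q : ℕ) {r : ℕ} (hr : r < M m i) :
    dirichletSeq m z (q * M m i + r) = psiSeq m z (q * M m i) * dirichletSeq m z r := by
  have h0 : dirichletSeq m z (q * M m i) = 0 :=
    dirichletSeq_of_dvd hm hs hs' ((M_dvd m hi).mul_left q)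
  rw [dirichletSeq] at h0
  rw [dirichletSeq, sum_range_add, h0, zero_add, dirichletSeq, mul_sum]
  exact sum_congr rfl fun j hj => psiSeq_add hm q ((mem_range.1 hj).trans hr)

lemma norm_dirichletSeq_le (hm : ∀ k, 2 ≤ m k) (hz : ∀ k, ‖z k‖ = 1) {s : ℕ}
    (hs : z s ^ m s = 1) (hs' : z s ≠ 1) (n : ℕ) : ‖dirichletSeq m z n‖ ≤ M m (s + 1) := by
  have hr := Nat.mod_lt n (M_pos hm (s + 1))
  rw [← Nat.div_add_mod' n (M m (s + 1)), dirichletSeq_add hm hs hs' s.lt_succ_self _ hr,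
    norm_mul, norm_psiSeq hz, one_mul]
  calc ‖dirichletSeq m z (n % M m (s + 1))‖
      ≤ ∑ k ∈ range (n % M m (s + 1)), ‖psiSeq m z k‖ := norm_sum_le _ _
    _ = (n % M m (s + 1) : ℕ) := by simp [norm_psiSeq hz]
    _ ≤ M m (s + 1) := by exact_mod_cast hr.le

lemma sum_dirichletSeq_eq_zero (hm : ∀ k, 2 ≤ m k) {s j n : ℕ} (hsj : s < j)
    (hs : z s ^ m s = 1) (hs' : z s ≠ 1) (hj : z j ^ m j = 1) (hj' : z j ≠ 1)
    (h : M m (j + 1) ∣ n) : ∑ k ∈ range n, dirichletSeq m z k = 0 := by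
  have block : ∑ k ∈ range (M m (j + 1)), dirichletSeq m z k = 0 := by
    rw [M, sum_range_mul_eq]
    have : ∀ d ∈ range (m j), ∑ r ∈ range (M m j), dirichletSeq m z (d * M m j + r) =
        z j ^ d * ∑ r ∈ range (M m j), dirichletSeq m z r := by
      intro d hd
      rw [mul_sum]
      refine sum_congr rfl fun r hr => ?_
      rw [dirichletSeq_add hm hs hs' hsj d (mem_range.1 hr), psiSeq_mul_M hm (mem_range.1 hd)]
    rw [sum_congr rfl this, ← sum_mul, sum_pow_eq_zero hj hj', zero_mul]
  obtain ⟨q, rfl⟩ := h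
  rw [mul_comm, sum_range_mul_eq]
  refine sum_eq_zero fun d _ => ?_
  rw [sum_congr rfl fun r hr =>
    dirichletSeq_add hm hs hs' (hsj.trans j.lt_succ_self) d (mem_range.1 hr), ← mul_sum, block,
    mul_zero]

end Kernel

lemma rad_pow {m : ℕ → ℕ} (hm : ∀ k, 2 ≤ m k) (k : ℕ) (x : G m) : rad m k x ^ m k = 1 := by
  have h0 : (m k : ℂ) ≠ 0 := by have := hm k; exact_mod_cast (by omega : m k ≠ 0)
  rw [rad, ← Complex.exp_nat_mul, mul_div_cancel₀ _ h0, mul_comm, Complex.exp_nat_mul_two_pi_mul_I]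

lemma norm_rad (m : ℕ → ℕ) (k : ℕ) (x : G m) : ‖rad m k x‖ = 1 := by
  have : 2 * (Real.pi : ℂ) * Complex.I * ((x k).val : ℂ) / (m k : ℂ) =
      ((2 * Real.pi * (x k).val / m k : ℝ) : ℂ) * Complex.I := by push_cast; ring
  rw [rad, this, Complex.norm_exp_ofReal_mul_I]

lemma rad_eq_one_of_eq_zero (m : ℕ → ℕ) {k : ℕ} {x : G m} (h : x k = 0) : rad m k x = 1 := by
  simp [rad, h]

lemma rad_ne_one {m : ℕ → ℕ} (hm : ∀ k, 2 ≤ m k) {k : ℕ} {x : G m} (h : x k ≠ 0) :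
    rad m k x ≠ 1 := by
  have hk : m k ≠ 0 := by have := hm k; omega
  have : NeZero (m k) := ⟨hk⟩
  have : rad m k x = Complex.exp (2 * Real.pi * Complex.I / m k) ^ (x k).val := by
    rw [rad, ← Complex.exp_nat_mul]; congr 1; ring
  rw [this, Ne, (Complex.isPrimitiveRoot_exp (m k) hk).pow_eq_one_iff_dvd]
  intro hd
  have h1 := Nat.eq_zero_of_dvd_of_lt hd (ZMod.val_lt (x k))
  exact h ((ZMod.val_eq_zero _).1 h1)

lemma psi_mul_conj_psi (m : ℕ → ℕ) (n : ℕ) (x t : G m) :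
    psi m n x * (starRingEnd ℂ) (psi m n t) =
      psiSeq m (fun k => rad m k x * (starRingEnd ℂ) (rad m k t)) n := by
  simp only [psi, psiSeq, map_prod, map_pow, ← prod_mul_distrib, mul_pow]

lemma psi_eq_one {m : ℕ → ℕ} (hm : ∀ k, 2 ≤ m k) {N n : ℕ} (hn : n < M m N) {t : G m}
    (ht : t ∈ cyl m N 0) : psi m n t = 1 := by
  refine prod_eq_one fun k _ => ?_
  rcases lt_or_ge k N with h | h
  · rw [rad_eq_one_of_eq_zero m (ht k h), one_pow]
  · rw [digit_eq_zero_of_lt m (hn.trans_le (Nat.le_of_dvd (M_pos hm k) (M_dvd m h))), pow_zero]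

lemma norm_psi (m : ℕ → ℕ) (n : ℕ) (x : G m) : ‖psi m n x‖ = 1 := by
  simp [psi, norm_rad]

lemma measurable_psi (m : ℕ → ℕ) (n : ℕ) : Measurable (psi m n) := by
  unfold psi rad
  refine Finset.measurable_fun_prod _ fun k _ => Measurable.pow_const ?_ _
  exact (measurable_from_top (f := fun v : ZMod (m k) =>
    Complex.exp (2 * (Real.pi : ℂ) * Complex.I * (v.val : ℂ) / (m k : ℂ)))).comp
    (measurable_pi_apply k)

lemma measurableSet_cyl (m : ℕ → ℕ) (n : ℕ) (x : G m) : MeasurableSet (cyl m n x) := by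
  have : cyl m n x = ⋂ j, ⋂ (_ : j < n), (fun y : G m => y j) ⁻¹' {x j} := by
    ext y; simp [cyl]
  rw [this]
  exact MeasurableSet.iInter fun j => MeasurableSet.iInter fun _ =>
    measurable_pi_apply j MeasurableSpace.measurableSet_top

section Atom

variable {m : ℕ → ℕ} {μ : Measure (G m)} {N : ℕ} {a : G m → ℂ}

lemma fhat_eq_zero (hm : ∀ k, 2 ≤ m k) (hsupp : ∀ x, x ∉ cyl m N 0 → a x = 0)
    (hmean : ∫ x, a x ∂μ = 0) {k : ℕ} (hk : k < M m N) : fhat m μ a k = 0 := by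
  rw [fhat, ← hmean]
  congr 1 with x
  by_cases hx : x ∈ cyl m N 0
  · simp [psi_eq_one hm hk hx]
  · simp [hsupp x hx]

lemma sigma_eq_zero (hm : ∀ k, 2 ≤ m k) (hsupp : ∀ x, x ∉ cyl m N 0 → a x = 0)
    (hmean : ∫ x, a x ∂μ = 0) {n : ℕ} (hn : n < M m N) (x : G m) : sigma m μ a n x = 0 := by
  refine mul_eq_zero_of_right _ (sum_eq_zero fun k hk => sum_eq_zero fun j hj => ?_)
  rw [mem_range] at hk hj
  rw [fhat_eq_zero hm hsupp hmean (by omega), zero_mul]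

lemma sigma_eq_integral (ha : Integrable a μ) (n : ℕ) (x : G m) :
    sigma m μ a n x = ∫ t, a t * ((n : ℂ)⁻¹ * ∑ k ∈ range n,
      dirichletSeq m (fun k => rad m k x * (starRingEnd ℂ) (rad m k t)) k) ∂μ := by
  have hi : ∀ j, Integrable (fun t => a t * (starRingEnd ℂ) (psi m j t) * psi m j x) μ := by
    intro j
    refine (ha.mul_bdd (c := 1) ?_ ?_).mul_const _
    · exact (Complex.continuous_conj.measurable.comp (measurable_psi m j)).aestronglyMeasurable
    · exact ae_of_all _ fun t => by simp [norm_psi]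
  simp only [sigma, S, fhat, ← integral_mul_const]
  simp_rw [← integral_finsetSum _ (fun j _ => hi j)]
  rw [← integral_finsetSum _ (fun k _ => integrable_finsetSum _ (fun j _ => hi j)),
    ← integral_const_mul]
  congr 1 with t
  simp only [dirichletSeq, ← psi_mul_conj_psi, mul_sum]
  refine sum_congr rfl fun k _ => sum_congr rfl fun j _ => ?_
  ring

lemma norm_sigma_le (hμ : IsVilenkinMeasure m μ) (ha : Integrable a μ)
    {B c : ℝ} (hB : 0 ≤ B) (haB : ∀ x, ‖a x‖ ≤ B) (hsupp : ∀ x, x ∉ cyl m N 0 → a x = 0)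
    {n : ℕ} {x : G m} (hc : ∀ t ∈ cyl m N 0, ‖(n : ℂ)⁻¹ * ∑ k ∈ range n,
      dirichletSeq m (fun k => rad m k x * (starRingEnd ℂ) (rad m k t)) k‖ ≤ c) :
    ‖sigma m μ a n x‖ ≤ B * c / M m N := by
  have := hμ.1
  have hreal : μ.real (cyl m N 0) = (M m N : ℝ)⁻¹ := by
    simp [Measure.real, hμ.2]
  rw [sigma_eq_integral ha]
  calc _ ≤ ∫ t, (cyl m N 0).indicator (fun _ => B * c) t ∂μ := by
        refine norm_integral_le_of_norm_le
          ((integrable_const _).indicator (measurableSet_cyl m N 0)) (ae_of_all _ fun t => ?_)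
        by_cases ht : t ∈ cyl m N 0
        · rw [Set.indicator_of_mem ht, norm_mul]
          exact mul_le_mul (haB t) (hc t ht) (norm_nonneg _) hB
        · simp [ht, hsupp t ht]
    _ = B * c / M m N := by
        rw [integral_indicator_const _ (measurableSet_cyl m N 0), hreal, smul_eq_mul]
        ring

end Atom

lemma conj_factor {m : ℕ → ℕ} {N k : ℕ} (hk : k < N) {t : G m} (ht : t ∈ cyl m N 0) (x : G m) :
    rad m k x * (starRingEnd ℂ) (rad m k t) = rad m k x := by
  rw [rad_eq_one_of_eq_zero m (ht k hk), map_one, mul_one]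

lemma norm_kernel_le {m : ℕ → ℕ} (hm : ∀ k, 2 ≤ m k) {N s : ℕ} (hs : s < N) {x t : G m}
    (hx : x s ≠ 0) (ht : t ∈ cyl m N 0) (n : ℕ) :
    ‖(n : ℂ)⁻¹ * ∑ k ∈ range n,
      dirichletSeq m (fun k => rad m k x * (starRingEnd ℂ) (rad m k t)) k‖ ≤ M m (s + 1) := by
  set z : ℕ → ℂ := fun k => rad m k x * (starRingEnd ℂ) (rad m k t) with hz
  have hzs : z s = rad m s x := conj_factor hs ht x
  have hn : ∀ k, ‖z k‖ = 1 := fun k => by simp [hz, norm_rad]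
  have hsum : ‖∑ k ∈ range n, dirichletSeq m z k‖ ≤ n * (M m (s + 1) : ℝ) := by
    calc _ ≤ ∑ k ∈ range n, ‖dirichletSeq m z k‖ := norm_sum_le _ _
      _ ≤ ∑ k ∈ range n, (M m (s + 1) : ℝ) := sum_le_sum fun k _ =>
          norm_dirichletSeq_le hm hn (hzs ▸ rad_pow hm s x) (hzs ▸ rad_ne_one hm hx) k
      _ = _ := by simp
  rcases Nat.eq_zero_or_pos n with rfl | hpos
  · simp
  have hp : (0 : ℝ) < n := by exact_mod_cast hpos
  rw [norm_mul, norm_inv, Complex.norm_natCast, inv_mul_le_iff₀ hp]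
  exact hsum

lemma kernel_eq_zero {m : ℕ → ℕ} (hm : ∀ k, 2 ≤ m k) {N s j : ℕ} (hsj : s < j) (hj : j < N)
    {x t : G m} (hxs : x s ≠ 0) (hxj : x j ≠ 0) (ht : t ∈ cyl m N 0) {n : ℕ}
    (hn : M m (j + 1) ∣ n) :
    (n : ℂ)⁻¹ * ∑ k ∈ range n,
      dirichletSeq m (fun k => rad m k x * (starRingEnd ℂ) (rad m k t)) k = 0 := by
  have h1 := conj_factor (hsj.trans hj) ht x
  have h2 := conj_factor hj ht x
  refine mul_eq_zero_of_right _ (sum_dirichletSeq_eq_zero hm hsj ?_ ?_ ?_ ?_ hn)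
  · rw [h1]; exact rad_pow hm s x
  · rw [h1]; exact rad_ne_one hm hxs
  · rw [h2]; exact rad_pow hm j x
  · rw [h2]; exact rad_ne_one hm hxj

/-- The points whose coordinates below `L` vanish, except possibly the coordinate `s`. -/
def almostCyl (m : ℕ → ℕ) (L s : ℕ) : Set (G m) := {y | ∀ j < L, j ≠ s → y j = 0}

lemma almostCyl_eq (m : ℕ → ℕ) (L s : ℕ) :
    almostCyl m L s = ⋃ v : ZMod (m s), cyl m L (Function.update 0 s v) := by
  ext y
  simp only [almostCyl, cyl, Set.mem_ofPred_eq, Set.mem_iUnion]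
  constructor
  · intro h
    refine ⟨y s, fun j hj => ?_⟩
    by_cases hjs : j = s
    · subst hjs; simp
    · simp [hjs, h j hj hjs]
  · rintro ⟨v, hv⟩ j hj hjs
    simpa [hjs] using hv j hj

lemma measurableSet_almostCyl {m : ℕ → ℕ} (hm : ∀ k, 2 ≤ m k) (L s : ℕ) :
    MeasurableSet (almostCyl m L s) := by
  have : NeZero (m s) := ⟨by have := hm s; omega⟩
  rw [almostCyl_eq]
  exact MeasurableSet.iUnion fun v => measurableSet_cyl m L _

lemma measureReal_almostCyl_le {m : ℕ → ℕ} (hm : ∀ k, 2 ≤ m k) {μ : Measure (G m)}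
    (hμ : IsVilenkinMeasure m μ) (L s : ℕ) : μ.real (almostCyl m L s) ≤ m s / M m L := by
  have : NeZero (m s) := ⟨by have := hm s; omega⟩
  rw [almostCyl_eq]
  refine (measureReal_iUnion_fintype_le _).trans (le_of_eq ?_)
  simp [Measure.real, hμ.2, ZMod.card, div_eq_mul_inv]

lemma sum_rpow_M_div_le {m : ℕ → ℕ} (hm : ∀ k, 2 ≤ m k) {p : ℝ} (hp : 0 < p) (N : ℕ) :
    ∑ s ∈ range N, ((M m (s + 1) : ℝ) / M m N) ^ p ≤ (1 - (1 / 2 : ℝ) ^ p)⁻¹ := by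
  have hq0 : (0 : ℝ) ≤ (1 / 2 : ℝ) ^ p := by positivity
  have hq1 : (1 / 2 : ℝ) ^ p < 1 := Real.rpow_lt_one (by norm_num) (by norm_num) hp
  rw [← sum_range_reflect]
  calc _ ≤ ∑ j ∈ range N, ((1 / 2 : ℝ) ^ p) ^ j := by
        refine sum_le_sum fun j hj => ?_
        rw [mem_range] at hj
        have hN : (0 : ℝ) < M m N := by exact_mod_cast M_pos hm N
        have h := two_pow_mul_M_le hm (N - 1 - j + 1) j
        rw [show N - 1 - j + 1 + j = N by omega] at h
        have h' : (2 : ℝ) ^ j * M m (N - 1 - j + 1) ≤ M m N := by exact_mod_cast h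
        rw [← Real.rpow_natCast, ← Real.rpow_mul (by norm_num), mul_comm p,
          Real.rpow_mul (by norm_num), Real.rpow_natCast]
        refine Real.rpow_le_rpow (by positivity) ?_ hp.le
        rw [div_le_iff₀ hN, one_div, inv_pow, inv_mul_eq_div, le_div_iff₀ (by positivity)]
        linarith
    _ ≤ (1 - (1 / 2 : ℝ) ^ p)⁻¹ := by
        rw [← tsum_geometric_of_lt_one hq0 hq1]
        exact (summable_geometric_of_lt_one hq0 hq1).sum_le_tsum _ fun _ _ => by positivity

/-- Off its support, the Fejér means of an atom are bounded in terms of the first nonzero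
coordinate `s` of the point, and vanish if there is a second one below `N - A`. -/
lemma exists_norm_sigma_le {m : ℕ → ℕ} (hm : ∀ k, 2 ≤ m k) {μ : Measure (G m)}
    (hμ : IsVilenkinMeasure m μ) {N A : ℕ} {a : G m → ℂ} (ha : Integrable a μ) {B : ℝ}
    (hB : 0 ≤ B) (haB : ∀ x, ‖a x‖ ≤ B) (hsupp : ∀ x, x ∉ cyl m N 0 → a x = 0)
    (hmean : ∫ x, a x ∂μ = 0) {x : G m} (hx : x ∉ cyl m N 0) :
    ∃ s < N, ∀ n, hi m n - lo m n ≤ A → ‖sigma m μ a n x‖ ≤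
      (almostCyl m (max s (N - A)) s).indicator (fun _ => B * M m (s + 1) / M m N) x := by
  have hex : ∃ j, j < N ∧ x j ≠ 0 := by simpa [cyl] using hx
  classical
  obtain ⟨hsN, hxs⟩ := Nat.find_spec hex
  have hmin : ∀ i < Nat.find hex, x i = 0 := fun i hi => by
    by_contra h
    exact Nat.find_min hex hi ⟨hi.trans hsN, h⟩
  generalize Nat.find hex = s at hsN hxs hmin
  refine ⟨s, hsN, fun n hn => ?_⟩
  by_cases hmem : x ∈ almostCyl m (max s (N - A)) s
  · rw [Set.indicator_of_mem hmem]
    exact norm_sigma_le hμ ha hB haB hsupp fun t ht => norm_kernel_le hm hsN hxs ht n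
  · rw [Set.indicator_of_notMem hmem]
    rcases lt_or_ge n (M m N) with hlt | hge
    · rw [sigma_eq_zero hm hsupp hmean hlt, norm_zero]
    have hex2 : ∃ j, (j < s ∨ j < N - A) ∧ j ≠ s ∧ x j ≠ 0 := by
      simpa [almostCyl] using hmem
    obtain ⟨j, hj, hjs, hxj⟩ := hex2
    have hsj : s < j := by
      by_contra! hle
      exact hxj (hmin j (lt_of_le_of_ne hle hjs))
    have hdvd : M m (j + 1) ∣ n := by
      have := le_hi hm hge
      exact (M_dvd m (by omega)).trans (M_lo_dvd m n)
    have := norm_sigma_le hμ ha hB haB hsupp (n := n) (x := x) (c := 0) fun t ht => by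
      rw [kernel_eq_zero hm hsj (by omega) hxs hxj ht hdvd, norm_zero]
    simpa using this

end Vilenkin

open Vilenkin

theorem statement14 (p : ℝ) (hp1 : 0 < p) (hp2 : p ≤ 1 / 2) (lam A : ℕ) :
    ∃ C : ℝ, 0 < C ∧ ∀ (m : ℕ → ℕ), (∀ k, 2 ≤ m k) → (∀ k, m k ≤ lam) →
      ∀ (μ : Measure (G m)), IsVilenkinMeasure m μ →
      ∀ nseq : ℕ → ℕ, (∀ k, 1 ≤ nseq k) → (∀ k, hi m (nseq k) - lo m (nseq k) ≤ A) →
      ∀ N : ℕ, ∀ a : G m → ℂ, Measurable a →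
        (∀ x, ‖a x‖ ≤ (M m N : ℝ) ^ (1 / p)) →
        (∀ x, x ∉ cyl m N 0 → a x = 0) → (∫ x, a x ∂μ) = 0 →
      (∫ x in (cyl m N 0)ᶜ, (⨆ k, ‖sigma m μ a (nseq k) x‖) ^ p ∂μ) ≤ C := by
  have hq1 : (1 / 2 : ℝ) ^ p < 1 := Real.rpow_lt_one (by norm_num) (by norm_num) hp1
  have hq : 0 < (1 - (1 / 2 : ℝ) ^ p)⁻¹ := inv_pos.2 (by linarith)
  refine ⟨((lam : ℝ) + 1) ^ (A + 1) * (1 - (1 / 2 : ℝ) ^ p)⁻¹, by positivity, ?_⟩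
  intro m hm hl μ hμ nseq _ hA N a ham haB hsupp hmean
  have := hμ.1
  have ha : Integrable a μ := Integrable.of_bound ham.aestronglyMeasurable _ (ae_of_all _ haB)
  have hMN : (0 : ℝ) < M m N := by exact_mod_cast M_pos hm N
  have hB : (0 : ℝ) ≤ (M m N : ℝ) ^ (1 / p) := by positivity
  set B : ℝ := (M m N : ℝ) ^ (1 / p) with hBdef
  have hBp : B ^ p = M m N := by
    rw [hBdef, ← Real.rpow_mul hMN.le, one_div, inv_mul_cancel₀ hp1.ne', Real.rpow_one]
  have hterm : ∀ s, 0 ≤ (B * M m (s + 1) / M m N) ^ p := fun s => by positivity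
  let g : G m → ℝ := fun x => ∑ s ∈ range N,
    (almostCyl m (max s (N - A)) s).indicator (fun _ => (B * M m (s + 1) / M m N) ^ p) x
  have hint : ∀ s ∈ range N, Integrable ((almostCyl m (max s (N - A)) s).indicator
      (fun _ => (B * M m (s + 1) / M m N) ^ p)) (μ.restrict (cyl m N 0)ᶜ) := fun s _ =>
    (integrable_const _).indicator (measurableSet_almostCyl hm _ _)
  have hbound : ∀ x ∈ (cyl m N 0)ᶜ, (⨆ k, ‖sigma m μ a (nseq k) x‖) ^ p ≤ g x := by
    intro x hx
    obtain ⟨s, hs, h⟩ := exists_norm_sigma_le hm hμ ha hB haB hsupp hmean hx (A := A)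
    have h1 : (⨆ k, ‖sigma m μ a (nseq k) x‖) ≤ _ := ciSup_le fun k => h _ (hA k)
    have h0 : 0 ≤ ⨆ k, ‖sigma m μ a (nseq k) x‖ := Real.iSup_nonneg fun k => norm_nonneg _
    refine (Real.rpow_le_rpow h0 h1 hp1.le).trans (le_trans (le_of_eq ?_)
      (single_le_sum (f := fun s => (almostCyl m (max s (N - A)) s).indicator
        (fun _ => (B * M m (s + 1) / M m N) ^ p) x)
        (fun i _ => Set.indicator_nonneg (fun _ _ => hterm i) x) (mem_range.2 hs)))
    by_cases hmem : x ∈ almostCyl m (max s (N - A)) s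
    · simp [hmem]
    · simp [hmem, Real.zero_rpow hp1.ne']
  have hmeas : ∀ s, μ.real (almostCyl m (max s (N - A)) s) ≤
      ((lam : ℝ) + 1) ^ (A + 1) / M m N := by
    intro s
    refine (measureReal_almostCyl_le hm hμ _ s).trans ?_
    set L := max s (N - A) with hL
    have hML : (0 : ℝ) < M m L := by exact_mod_cast M_pos hm L
    rw [div_le_div_iff₀ hML hMN]
    have h1 : M m N ≤ (lam + 1) ^ A * M m L :=
      (Nat.le_of_dvd (M_pos hm _) (M_dvd m (by omega : N ≤ L + A))).trans
        (M_add_le (fun k => (hl k).trans (Nat.le_succ _)) L A)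
    have h2 : m s * M m N ≤ (lam + 1) ^ (A + 1) * M m L := by
      calc m s * M m N ≤ (lam + 1) * ((lam + 1) ^ A * M m L) :=
            Nat.mul_le_mul ((hl s).trans (Nat.le_succ _)) h1
        _ = _ := by ring
    exact_mod_cast h2
  calc ∫ x in (cyl m N 0)ᶜ, (⨆ k, ‖sigma m μ a (nseq k) x‖) ^ p ∂μ
      ≤ ∫ x in (cyl m N 0)ᶜ, g x ∂μ := by
        refine integral_mono_of_nonneg (ae_of_all _ fun x => ?_) (integrable_finsetSum _ hint)
          ((ae_restrict_iff' (measurableSet_cyl m N 0).compl).2 (ae_of_all _ hbound))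
        exact Real.rpow_nonneg (Real.iSup_nonneg fun k => norm_nonneg _) p
    _ = ∑ s ∈ range N, (μ.restrict (cyl m N 0)ᶜ).real (almostCyl m (max s (N - A)) s) *
          (B * M m (s + 1) / M m N) ^ p := by
        rw [integral_finsetSum _ hint]
        refine sum_congr rfl fun s _ => ?_
        rw [integral_indicator_const _ (measurableSet_almostCyl hm _ _), smul_eq_mul]
    _ ≤ ∑ s ∈ range N, ((lam : ℝ) + 1) ^ (A + 1) * ((M m (s + 1) : ℝ) / M m N) ^ p := by
        refine sum_le_sum fun s _ => ?_
        have h1 : (μ.restrict (cyl m N 0)ᶜ).real (almostCyl m (max s (N - A)) s) ≤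
            μ.real (almostCyl m (max s (N - A)) s) :=
          ENNReal.toReal_mono (measure_ne_top _ _) (Measure.restrict_le_self _)
        refine (mul_le_mul_of_nonneg_right (h1.trans (hmeas s)) (hterm s)).trans (le_of_eq ?_)
        rw [mul_div_assoc, Real.mul_rpow hB (by positivity), hBp]
        field_simp
    _ ≤ _ := by
        rw [← mul_sum]
        exact mul_le_mul_of_nonneg_left (sum_rpow_M_div_le hm hp1 N) (by positivity)
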